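/- arXiv:math/0608492 — 3 statements merged into one kernel-verified Lean document; each statement's English description precedes it below -/
import Mathlib

section
/- Suppose X₁(0,0) ≠ 0. Let u be analytic in a neighborhood of (0,0) and satisfy X(u) = 2·B₀·u + B₂ in a neighborhood of (0,0). Then there exists a function w, analytic in a neighborhood of (0,0), satisfying the system ∂₂w = u + (1/2)·w² and ∂₁w = −∂₂²(X₂/X₁) − (X₂/X₁)·u − ∂₂(X₂/X₁)·w − (1/2)·(X₂/X₁)·w² in a neighborhood of (0,0). -/
open Filter MvPolynomial

/-- Evaluation of a polynomial in two variables at a point of `ℂ × ℂ`. -/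
noncomputable def pev (P : MvPolynomial (Fin 2) ℂ) (p : ℂ × ℂ) : ℂ :=
  MvPolynomial.eval ![p.1, p.2] P

/-- Partial derivative with respect to the first variable. -/
noncomputable def d1 : (ℂ × ℂ → ℂ) → (ℂ × ℂ → ℂ) :=
  fun f p => deriv (fun x => f (x, p.2)) p.1

/-- Partial derivative with respect to the second variable. -/
noncomputable def d2 : (ℂ × ℂ → ℂ) → (ℂ × ℂ → ℂ) :=
  fun f p => deriv (fun y => f (p.1, y)) p.2

/-- The differential operator `X(g) = X₁·∂₁g + X₂·∂₂g`. -/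
noncomputable def Xop (X₁ X₂ : MvPolynomial (Fin 2) ℂ) (f : ℂ × ℂ → ℂ) : ℂ × ℂ → ℂ :=
  fun p => pev X₁ p * d1 f p + pev X₂ p * d2 f p

/-- A first integral of `X` at `p`: a nonconstant function, analytic near `p`,
annihilated by `X` near `p`. -/
def IsFirstIntegralAt (X₁ X₂ : MvPolynomial (Fin 2) ℂ) (ω : ℂ × ℂ → ℂ) (p : ℂ × ℂ) : Prop :=
  AnalyticAt ℂ ω p ∧ (∀ᶠ q in nhds p, Xop X₁ X₂ ω q = 0) ∧
    ¬ ∃ c : ℂ, ∀ᶠ q in nhds p, ω q = c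

/-- The functions `Bᵢ = −X₁·∂₂^{i+1}(X₂/X₁)`. -/
noncomputable def B (X₁ X₂ : MvPolynomial (Fin 2) ℂ) (i : ℕ) : ℂ × ℂ → ℂ :=
  fun p => -(pev X₁ p) * (d2^[i + 1] (fun q => pev X₂ q / pev X₁ q)) p

open scoped unitInterval Topology ContDiff

/-- Post-composition with a germ of analytic function at `0` is analytic on continuous maps. -/
theorem exists_analyticAt_postcomp {K E F : Type*} [TopologicalSpace K] [CompactSpace K]
    [NormedAddCommGroup E] [NormedSpace ℂ E] [NormedAddCommGroup F] [NormedSpace ℂ F]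
    [CompleteSpace F] {A : E → F} (hA : AnalyticAt ℂ A 0) :
    ∃ N : C(K, E) → C(K, F), AnalyticAt ℂ N 0 ∧ ∀ᶠ f in 𝓝 0, ∀ t, N f t = A (f t) := by
  obtain ⟨p, r, hp⟩ := hA
  let q : FormalMultilinearSeries ℂ C(K, E) C(K, F) := fun n =>
    MultilinearMap.mkContinuous
      { toFun := fun f => ⟨fun t => p n (fun i => f i t), by fun_prop⟩
        map_update_add' := by
          intro _ f i a b
          ext t
          have h : ∀ c : C(K, E), (fun j => Function.update f i c j t) =
              Function.update (fun j => f j t) i (c t) := by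
            intro c
            ext j
            by_cases hj : j = i
            · subst hj; simp
            · simp [hj]
          simp [h]
        map_update_smul' := by
          intro _ f i a b
          ext t
          have h : ∀ c : C(K, E), (fun j => Function.update f i c j t) =
              Function.update (fun j => f j t) i (c t) := by
            intro c
            ext j
            by_cases hj : j = i
            · subst hj; simp
            · simp [hj]
          simp [h] } ‖p n‖ (by
        intro f
        refine (ContinuousMap.norm_le _ (by positivity)).2 fun t => ?_
        refine ((p n).le_opNorm _).trans ?_
        gcongr with i
        exact (f i).norm_coe_le_norm t)
  have hqp : p.radius ≤ q.radius := FormalMultilinearSeries.radius_le_of_le fun n =>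
    MultilinearMap.mkContinuous_norm_le _ (norm_nonneg _) _
  have hr : r ≤ q.radius := hp.r_le.trans hqp
  have hq := q.hasFPowerSeriesOnBall (hp.r_pos.trans_le hr)
  refine ⟨q.sum, hq.analyticAt, ?_⟩
  filter_upwards [Metric.eball_mem_nhds (0 : C(K, E)) hp.r_pos] with f hf t
  have h1 := hq.hasSum (Metric.eball_subset_eball hr hf)
  have h2 := h1.mapL (ContinuousMap.evalCLM ℂ t)
  have hft : f t ∈ Metric.eball (0 : E) r := by
    rw [Metric.mem_eball, edist_zero_right] at hf ⊢
    refine lt_of_le_of_lt ?_ hf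
    exact ENNReal.coe_le_coe.2 (f.norm_coe_le_norm t)
  have h3 := hp.hasSum hft
  simp only [zero_add] at h2 h3
  exact h2.unique h3

/-- The operator `f ↦ (t ↦ ∫₀ᵗ f)` on continuous functions on the unit interval. -/
noncomputable def volterra : C(I, ℂ) →L[ℂ] C(I, ℂ) :=
  LinearMap.mkContinuous
    { toFun := fun f => ⟨fun t => (t : ℂ) * ∫ s : I, f (t * s), by
        have h : Continuous fun t : I => ∫ s : I, f (t * s) := by
          refine MeasureTheory.continuous_of_dominated (bound := fun _ => ‖f‖)
            (fun t => ?_) (fun t => ?_) ?_ ?_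
          · exact (by fun_prop : Continuous fun s : I => f (t * s)).aestronglyMeasurable
          · exact .of_forall fun s => f.norm_coe_le_norm _
          · exact MeasureTheory.integrable_const _
          · exact .of_forall fun s => by fun_prop
        fun_prop⟩
      map_add' := fun f g => by
        ext t
        have hi : ∀ f : C(I, ℂ), MeasureTheory.Integrable fun s : I => f (t * s) := fun f =>
          (by fun_prop : Continuous fun s : I => f (t * s)).integrable_of_hasCompactSupport
            (HasCompactSupport.of_compactSpace _)
        simp [MeasureTheory.integral_add (hi f) (hi g), mul_add]
      map_smul' := fun c f => by
        ext t
        simp [MeasureTheory.integral_const_mul, mul_left_comm] } 1 (by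
    intro f
    rw [one_mul]
    refine (ContinuousMap.norm_le _ (by positivity)).2 fun t => ?_
    have h : ‖∫ s : I, f (t * s)‖ ≤ ‖f‖ := by
      simpa using MeasureTheory.norm_integral_le_of_norm_le_const (μ := MeasureTheory.volume)
        (.of_forall fun s : I => f.norm_coe_le_norm (t * s))
    have ht : ‖(t : ℂ)‖ ≤ 1 := by
      rw [Complex.norm_real, Real.norm_of_nonneg t.2.1]; exact t.2.2
    calc ‖(t : ℂ) * ∫ s : I, f (t * s)‖ = ‖(t : ℂ)‖ * ‖∫ s : I, f (t * s)‖ := norm_mul _ _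
      _ ≤ 1 * ‖f‖ := by gcongr
      _ = ‖f‖ := one_mul _)

theorem volterra_apply (f : C(I, ℂ)) (t : I) :
    volterra f t = (t : ℂ) * ∫ s : I, f (t * s) := rfl

/-- The linear map `((x, y), W) ↦ (t ↦ (x, t y, W t))`. -/
noncomputable def rayGraph : (ℂ × ℂ) × C(I, ℂ) →L[ℂ] C(I, ℂ × ℂ × ℂ) :=
  LinearMap.mkContinuous
    { toFun := fun v => ⟨fun t => (v.1.1, (t : ℂ) * v.1.2, v.2 t), by fun_prop⟩
      map_add' := fun v w => by ext t <;> simp [mul_add]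
      map_smul' := fun c v => by ext t <;> simp [mul_left_comm] } 1 (by
    intro v
    rw [one_mul]
    refine (ContinuousMap.norm_le _ (by positivity)).2 fun t => ?_
    have ht : ‖(t : ℂ)‖ ≤ 1 := by
      rw [Complex.norm_real, Real.norm_of_nonneg t.2.1]; exact t.2.2
    have h1 : ‖v.1‖ ≤ ‖v‖ := norm_fst_le v
    have h2 : ‖v.2‖ ≤ ‖v‖ := norm_snd_le v
    refine max_le ((norm_fst_le v.1).trans h1) (max_le ?_ ((v.2.norm_coe_le_norm t).trans h2))
    calc ‖(t : ℂ) * v.1.2‖ = ‖(t : ℂ)‖ * ‖v.1.2‖ := norm_mul _ _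
      _ ≤ 1 * ‖v‖ := by gcongr; exact (norm_snd_le v.1).trans h1
      _ = ‖v‖ := one_mul _)

theorem rayGraph_apply (v : (ℂ × ℂ) × C(I, ℂ)) (t : I) :
    rayGraph v t = (v.1.1, (t : ℂ) * v.1.2, v.2 t) := rfl

/-- Analytic solution of the integral form of `∂₂w = G(x, y, w)`, `w(x, 0) = c(x)`. -/
theorem exists_analyticAt_integral_equation {G : ℂ × ℂ × ℂ → ℂ} (hG : AnalyticAt ℂ G 0)
    {c : ℂ → ℂ} (hc : AnalyticAt ℂ c 0) (hc0 : c 0 = 0) :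
    ∃ w : ℂ × ℂ → ℂ, AnalyticAt ℂ w 0 ∧ w 0 = 0 ∧ ∀ᶠ p : ℂ × ℂ in 𝓝 0,
      w p = c p.1 + p.2 * ∫ s : I, G (p.1, s * p.2, w (p.1, s * p.2)) := by
  obtain ⟨N, hN, hNG⟩ := exists_analyticAt_postcomp (K := I) hG
  let Φ : (ℂ × ℂ) × C(I, ℂ) → C(I, ℂ) := fun v =>
    v.2 - c v.1.1 • (1 : C(I, ℂ)) - v.1.2 • volterra (N (rayGraph v))
  have hΦ0 : Φ 0 = 0 := by ext t; simp [Φ, hc0]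
  have hΦ : AnalyticAt ℂ Φ 0 := by
    have h1 : AnalyticAt ℂ (fun v : (ℂ × ℂ) × C(I, ℂ) => c v.1.1) 0 :=
      AnalyticAt.fun_comp (g := c) (f := fun v : (ℂ × ℂ) × C(I, ℂ) => v.1.1) hc
        (analyticAt_fst.fun_comp (f := fun v : (ℂ × ℂ) × C(I, ℂ) => v.1) analyticAt_fst)
    have h2 : AnalyticAt ℂ (fun v => N (rayGraph v)) 0 :=
      AnalyticAt.fun_comp (by simpa using hN) (rayGraph.analyticAt 0)
    have h3 : AnalyticAt ℂ (fun v => volterra (N (rayGraph v))) 0 :=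
      (volterra.analyticAt _).fun_comp h2
    have h4 : AnalyticAt ℂ (fun v : (ℂ × ℂ) × C(I, ℂ) => v.1.2) 0 :=
      analyticAt_snd.fun_comp (f := fun v : (ℂ × ℂ) × C(I, ℂ) => v.1) analyticAt_fst
    exact (analyticAt_snd.sub (h1.smul analyticAt_const)).sub (h4.smul h3)
  have cdf : ContDiffAt ℂ ω Φ 0 := hΦ.contDiffAt
  have hinv : (fderiv ℂ Φ 0 ∘L .inr ℂ (ℂ × ℂ) C(I, ℂ)).IsInvertible := by
    have h1 : HasFDerivAt (fun W : C(I, ℂ) => Φ (0, W))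
        (fderiv ℂ Φ 0 ∘L .inr ℂ (ℂ × ℂ) C(I, ℂ)) 0 :=
      HasFDerivAt.comp (g := Φ) (0 : C(I, ℂ)) hΦ.differentiableAt.hasFDerivAt
        (ContinuousLinearMap.inr ℂ (ℂ × ℂ) C(I, ℂ)).hasFDerivAt
    have h2 : (fun W : C(I, ℂ) => Φ (0, W)) = id := by
      ext W t
      simp [Φ, hc0]
    rw [h2] at h1
    rw [h1.unique (hasFDerivAt_id _)]
    exact ⟨.refl ℂ _, rfl⟩
  have hω : (ω : ℕ∞ω) ≠ 0 := by simp
  set ψ := cdf.implicitFunction hω hinv with hψ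
  have hψ0 : ψ 0 = 0 := cdf.implicitFunction_apply_self hω hinv
  have hψan : AnalyticAt ℂ ψ 0 := (cdf.contDiffAt_implicitFunction hω hinv).analyticAt
  have huniq : ∀ᶠ v in 𝓝 0, Φ v = 0 ↔ ψ v.1 = v.2 := by
    simpa [hΦ0] using cdf.eventually_apply_eq_iff_implicitFunction hω hinv
  have hNG' : ∀ᶠ v in 𝓝 0, ∀ t, N (rayGraph v) t = G (rayGraph v t) :=
    rayGraph.continuous.tendsto' 0 0 (map_zero _) |>.eventually hNG
  obtain ⟨ε, hε, hball⟩ := Metric.eventually_nhds_iff_ball.1 (huniq.and hNG')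
  have hψε : ∀ᶠ p in 𝓝 0, ψ p ∈ Metric.ball (0 : C(I, ℂ)) ε :=
    hψan.continuousAt.eventually (by rw [hψ0]; exact Metric.ball_mem_nhds _ hε)
  refine ⟨fun p => ψ p 1, ((ContinuousMap.evalCLM ℂ (1 : I)).analyticAt _).fun_comp hψan,
    by simp [hψ0], ?_⟩
  filter_upwards [hψε, Metric.ball_mem_nhds _ hε] with p hψp hp
  have hmem : (p, ψ p) ∈ Metric.ball (0 : (ℂ × ℂ) × C(I, ℂ)) ε := by
    rw [mem_ball_zero_iff] at *
    exact max_lt hp hψp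
  have key : ∀ t : I, ψ p t =
      c p.1 + p.2 * (t * ∫ s : I, G (p.1, (t * s : ℂ) * p.2, ψ p (t * s))) := by
    intro t
    have h := DFunLike.congr_fun ((hball _ hmem).1.2 rfl) t
    simp only [Φ, ContinuousMap.sub_apply, ContinuousMap.smul_apply, volterra_apply,
      (hball _ hmem).2, rayGraph_apply, ContinuousMap.one_apply, ContinuousMap.zero_apply,
      smul_eq_mul, mul_one, Set.Icc.coe_mul, Complex.ofReal_mul] at h
    linear_combination h
  have hscale : ∀ k : I, ψ (p.1, (k : ℂ) * p.2) 1 = ψ p k := by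
    intro k
    let R : C(I, ℂ) := ⟨fun t => ψ p (k * t), by fun_prop⟩
    have hk : ‖(k : ℂ)‖ ≤ 1 := by
      rw [Complex.norm_real, Real.norm_of_nonneg k.2.1]; exact k.2.2
    have hmem' : ((p.1, (k : ℂ) * p.2), R) ∈ Metric.ball (0 : (ℂ × ℂ) × C(I, ℂ)) ε := by
      rw [mem_ball_zero_iff] at *
      refine max_lt (max_lt ((norm_fst_le p).trans_lt hp) ?_) ?_
      · calc ‖(k : ℂ) * p.2‖ = ‖(k : ℂ)‖ * ‖p.2‖ := norm_mul _ _
          _ ≤ 1 * ‖p‖ := by gcongr; exact norm_snd_le p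
          _ < ε := by rwa [one_mul]
      · refine lt_of_le_of_lt ?_ hψp
        exact (ContinuousMap.norm_le _ (norm_nonneg _)).2 fun t => (ψ p).norm_coe_le_norm _
    have hR : ψ (p.1, (k : ℂ) * p.2) = R := by
      refine (hball _ hmem').1.1 ?_
      ext t
      have h := key (k * t)
      simp only [Φ, ContinuousMap.sub_apply, ContinuousMap.smul_apply, volterra_apply,
        (hball _ hmem').2, rayGraph_apply, ContinuousMap.one_apply, ContinuousMap.zero_apply,
        smul_eq_mul, mul_one, Set.Icc.coe_mul, Complex.ofReal_mul, R, ContinuousMap.coe_mk]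
      rw [h]
      have h2 : ∀ s : I, G (p.1, (t * s : ℂ) * (k * p.2), ψ p (k * (t * s))) =
          G (p.1, ((k * t : I) * s : ℂ) * p.2, ψ p (k * t * s)) := by
        intro s
        rw [mul_assoc k t s]
        congr 3
        push_cast
        ring
      simp only [h2]
      push_cast
      ring
    rw [hR]
    simp [R]
  have h1 := key 1
  simp only [hscale]
  simpa using h1

/-- Analytic local solvability of `∂₂w = G(x, y, w)`, `w(x, 0) = c(x)`, with `x` a parameter. -/
theorem exists_analyticAt_hasDerivAt {G : ℂ × ℂ × ℂ → ℂ} (hG : AnalyticAt ℂ G 0)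
    {c : ℂ → ℂ} (hc : AnalyticAt ℂ c 0) (hc0 : c 0 = 0) :
    ∃ w : ℂ × ℂ → ℂ, AnalyticAt ℂ w 0 ∧ w 0 = 0 ∧ ∀ᶠ p : ℂ × ℂ in 𝓝 0,
      w (p.1, 0) = c p.1 ∧
      HasDerivAt (fun y => w (p.1, y)) (G (p.1, p.2, w p)) p.2 := by
  obtain ⟨w, hw, hw0, hint⟩ := exists_analyticAt_integral_equation hG hc hc0
  refine ⟨w, hw, hw0, ?_⟩
  let g : ℂ × ℂ → ℂ := fun p => G (p.1, p.2, w p)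
  have hg : AnalyticAt ℂ g 0 :=
    AnalyticAt.fun_comp (g := G) (f := fun p : ℂ × ℂ => (p.1, p.2, w p)) (by rw [hw0]; exact hG)
      (analyticAt_fst.prod (analyticAt_snd.prod hw))
  obtain ⟨ε, hε, hball⟩ := Metric.eventually_nhds_iff_ball.1
    (hint.and hg.eventually_analyticAt)
  filter_upwards [Metric.ball_mem_nhds (0 : ℂ × ℂ) hε] with p hp
  rw [mem_ball_zero_iff] at hp
  have hmem : ∀ y ∈ Metric.ball (0 : ℂ) ε, (p.1, y) ∈ Metric.ball (0 : ℂ × ℂ) ε := by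
    intro y hy
    rw [mem_ball_zero_iff] at *
    exact max_lt ((norm_fst_le p).trans_lt hp) hy
  have hdiff : DifferentiableOn ℂ (fun y => g (p.1, y)) (Metric.ball 0 ε) := fun y hy =>
    ((hball _ (hmem y hy)).2.differentiableAt.comp y (by fun_prop :
      DifferentiableAt ℂ (fun y : ℂ => (p.1, y)) y)).differentiableWithinAt
  obtain ⟨H, hH0, hH⟩ := hdiff.isExactOn_ball.with_val_at 0 (c p.1)
  have hwH : ∀ y ∈ Metric.ball (0 : ℂ) ε, w (p.1, y) = H y := by
    intro y hy
    have hseg : ∀ t ∈ Set.Icc (0 : ℝ) 1, (0 : ℂ) + t • y ∈ Metric.ball (0 : ℂ) ε := by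
      intro t ht
      rw [mem_ball_zero_iff] at *
      rw [zero_add, norm_smul, Real.norm_of_nonneg ht.1]
      exact (mul_le_of_le_one_left (norm_nonneg _) ht.2).trans_lt hy
    have hcont : ContinuousOn (fun t : ℝ => g (p.1, 0 + t • y)) (Set.Icc 0 1) :=
      hdiff.continuousOn.comp (f := fun t : ℝ => (0 : ℂ) + t • y) (by fun_prop) hseg
    have hI := intervalIntegral.integral_unitInterval_deriv_eq_sub (f := H) (f' := fun y => g (p.1, y))
      (z₀ := 0) (z₁ := y) hcont (fun t ht => hH _ (hseg t ht))
    have h := (hball _ (hmem y hy)).1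
    have hII : ∫ s : I, g (p.1, s * y) = ∫ t in (0 : ℝ)..1, g (p.1, 0 + t • y) := by
      rw [intervalIntegral.integral_of_le zero_le_one, ← MeasureTheory.integral_Icc_eq_integral_Ioc,
        ← MeasureTheory.integral_subtype measurableSet_Icc]
      simp
    simp only [g] at hI hII
    rw [h]
    simp only
    rw [hII]
    rw [smul_eq_mul] at hI
    rw [hI, hH0]
    simp
  have hp2 : p.2 ∈ Metric.ball (0 : ℂ) ε := mem_ball_zero_iff.2 ((norm_snd_le p).trans_lt hp)
  refine ⟨(hwH 0 (Metric.mem_ball_self hε)).trans hH0, ?_⟩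
  refine (hH _ hp2).congr_of_eventuallyEq ?_
  filter_upwards [Metric.isOpen_ball.mem_nhds hp2] with y hy using hwH y hy

theorem hasDerivAt_fst_slice {f : ℂ × ℂ → ℂ} {p : ℂ × ℂ} (hf : DifferentiableAt ℂ f p) :
    HasDerivAt (fun x => f (x, p.2)) (fderiv ℂ f p (1, 0)) p.1 :=
  HasFDerivAt.comp_hasDerivAt (l := f) (f := fun x : ℂ => (x, p.2)) p.1 hf.hasFDerivAt
    ((hasDerivAt_id p.1).prodMk (hasDerivAt_const p.1 p.2))

theorem hasDerivAt_snd_slice {f : ℂ × ℂ → ℂ} {p : ℂ × ℂ} (hf : DifferentiableAt ℂ f p) :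
    HasDerivAt (fun y => f (p.1, y)) (fderiv ℂ f p (0, 1)) p.2 :=
  HasFDerivAt.comp_hasDerivAt (l := f) (f := fun y : ℂ => (p.1, y)) p.2 hf.hasFDerivAt
    ((hasDerivAt_const p.2 p.1).prodMk (hasDerivAt_id p.2))

theorem d1_eq_fderiv {f : ℂ × ℂ → ℂ} {p : ℂ × ℂ} (hf : DifferentiableAt ℂ f p) :
    d1 f p = fderiv ℂ f p (1, 0) :=
  (hasDerivAt_fst_slice hf).deriv

theorem d2_eq_fderiv {f : ℂ × ℂ → ℂ} {p : ℂ × ℂ} (hf : DifferentiableAt ℂ f p) :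
    d2 f p = fderiv ℂ f p (0, 1) :=
  (hasDerivAt_snd_slice hf).deriv

theorem hasDerivAt_d1 {f : ℂ × ℂ → ℂ} {p : ℂ × ℂ} (hf : AnalyticAt ℂ f p) :
    HasDerivAt (fun x => f (x, p.2)) (d1 f p) p.1 :=
  (hasDerivAt_fst_slice hf.differentiableAt).differentiableAt.hasDerivAt

theorem hasDerivAt_d2 {f : ℂ × ℂ → ℂ} {p : ℂ × ℂ} (hf : AnalyticAt ℂ f p) :
    HasDerivAt (fun y => f (p.1, y)) (d2 f p) p.2 :=
  (hasDerivAt_snd_slice hf.differentiableAt).differentiableAt.hasDerivAt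

theorem d1_eventuallyEq_fderiv {f : ℂ × ℂ → ℂ} {p : ℂ × ℂ} (hf : AnalyticAt ℂ f p) :
    d1 f =ᶠ[𝓝 p] fun q => fderiv ℂ f q (1, 0) :=
  hf.eventually_analyticAt.mono fun _ h => d1_eq_fderiv h.differentiableAt

theorem d2_eventuallyEq_fderiv {f : ℂ × ℂ → ℂ} {p : ℂ × ℂ} (hf : AnalyticAt ℂ f p) :
    d2 f =ᶠ[𝓝 p] fun q => fderiv ℂ f q (0, 1) :=
  hf.eventually_analyticAt.mono fun _ h => d2_eq_fderiv h.differentiableAt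

theorem analyticAt_fderiv_apply {f : ℂ × ℂ → ℂ} {p : ℂ × ℂ} (hf : AnalyticAt ℂ f p)
    (v : ℂ × ℂ) : AnalyticAt ℂ (fun q => fderiv ℂ f q v) p :=
  ((ContinuousLinearMap.apply ℂ ℂ v).analyticAt _).fun_comp hf.fderiv

theorem analyticAt_d1 {f : ℂ × ℂ → ℂ} {p : ℂ × ℂ} (hf : AnalyticAt ℂ f p) :
    AnalyticAt ℂ (d1 f) p :=
  (analyticAt_fderiv_apply hf _).congr (d1_eventuallyEq_fderiv hf).symm

theorem analyticAt_d2 {f : ℂ × ℂ → ℂ} {p : ℂ × ℂ} (hf : AnalyticAt ℂ f p) :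
    AnalyticAt ℂ (d2 f) p :=
  (analyticAt_fderiv_apply hf _).congr (d2_eventuallyEq_fderiv hf).symm

theorem fderiv_fderiv_apply {f : ℂ × ℂ → ℂ} {p : ℂ × ℂ} (hf : AnalyticAt ℂ f p)
    (v u : ℂ × ℂ) : fderiv ℂ (fun q => fderiv ℂ f q v) p u = fderiv ℂ (fderiv ℂ f) p u v := by
  have h := (ContinuousLinearMap.apply ℂ ℂ v).hasFDerivAt.comp p
    hf.fderiv.differentiableAt.hasFDerivAt
  exact DFunLike.congr_fun h.fderiv u

theorem d1_d2_comm {f : ℂ × ℂ → ℂ} {p : ℂ × ℂ} (hf : AnalyticAt ℂ f p) :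
    d1 (d2 f) p = d2 (d1 f) p := by
  rw [d1_eq_fderiv (analyticAt_d2 hf).differentiableAt,
    d2_eq_fderiv (analyticAt_d1 hf).differentiableAt,
    (d1_eventuallyEq_fderiv hf).fderiv_eq, (d2_eventuallyEq_fderiv hf).fderiv_eq,
    fderiv_fderiv_apply hf, fderiv_fderiv_apply hf]
  exact hf.contDiffAt.isSymmSndFDerivAt_of_omega.eq _ _

theorem analyticAt_pev (P : MvPolynomial (Fin 2) ℂ) (p : ℂ × ℂ) : AnalyticAt ℂ (pev P) p := by
  refine AnalyticAt.aeval_mvPolynomial (f := fun q : ℂ × ℂ => ![q.1, q.2]) (fun i => ?_) P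
  fin_cases i
  · exact analyticAt_fst
  · exact analyticAt_snd

/-- A solution of the linear equation `E' = h E` on a disc vanishing at the centre is zero. -/
theorem eq_zero_of_hasDerivAt_mul {r : ℝ} {E h : ℂ → ℂ} (hr : 0 < r)
    (hh : DifferentiableOn ℂ h (Metric.ball 0 r))
    (hE : ∀ y ∈ Metric.ball (0 : ℂ) r, HasDerivAt E (h y * E y) y) (hE0 : E 0 = 0) :
    ∀ y ∈ Metric.ball (0 : ℂ) r, E y = 0 := by
  obtain ⟨H, hH⟩ := hh.isExactOn_ball
  have hF : ∀ y ∈ Metric.ball (0 : ℂ) r,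
      HasDerivAt (fun y => E y * Complex.exp (-H y)) 0 y := fun y hy => by
    refine ((hE y hy).mul (hH y hy).neg.cexp).congr_deriv ?_
    simp only [Pi.neg_apply]
    ring
  intro y hy
  have h := Metric.isOpen_ball.is_const_of_deriv_eq_zero (convex_ball (0 : ℂ) r).isPreconnected
    (fun z hz => (hF z hz).differentiableAt.differentiableWithinAt)
    (fun z hz => (hF z hz).deriv) hy (Metric.mem_ball_self hr)
  simpa [hE0] using h

/-- If `∂₁u = −∂₂³a − 2 ∂₂a · u − a ∂₂u`, the associated Riccati system is solvable. -/
theorem exists_analyticAt_riccati_system {a u : ℂ × ℂ → ℂ} (ha : AnalyticAt ℂ a 0)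
    (hu : AnalyticAt ℂ u 0)
    (hua : ∀ᶠ q in 𝓝 0, d1 u q = -d2 (d2 (d2 a)) q - 2 * d2 a q * u q - a q * d2 u q) :
    ∃ w : ℂ × ℂ → ℂ, AnalyticAt ℂ w 0 ∧ ∀ᶠ q in 𝓝 0,
      d2 w q = u q + (1 / 2) * w q ^ 2 ∧
      d1 w q = -d2 (d2 a) q - a q * u q - d2 a q * w q - (1 / 2) * a q * w q ^ 2 := by
  let f : ℂ × ℂ → ℂ → ℂ := fun q W =>
    -d2 (d2 a) q - a q * u q - d2 a q * W - (1 / 2) * a q * W ^ 2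
  have ha2 := analyticAt_d2 ha
  have ha22 := analyticAt_d2 ha2
  have hι : AnalyticAt ℂ (fun v : ℂ × ℂ × ℂ => ((v.2.1, 0) : ℂ × ℂ)) 0 :=
    (analyticAt_fst.fun_comp (f := fun v : ℂ × ℂ × ℂ => v.2) analyticAt_snd).prod
      analyticAt_const
  have hπ : AnalyticAt ℂ (fun v : ℂ × ℂ × ℂ => ((v.1, v.2.1) : ℂ × ℂ)) 0 :=
    analyticAt_fst.prod
      (analyticAt_fst.fun_comp (f := fun v : ℂ × ℂ × ℂ => v.2) analyticAt_snd)
  have hW : AnalyticAt ℂ (fun v : ℂ × ℂ × ℂ => v.2.2) 0 :=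
    analyticAt_snd.fun_comp (f := fun v : ℂ × ℂ × ℂ => v.2) analyticAt_snd
  have hι' : ∀ {g : ℂ × ℂ → ℂ}, AnalyticAt ℂ g 0 →
      AnalyticAt ℂ (fun v : ℂ × ℂ × ℂ => g (v.2.1, 0)) 0 := fun hg =>
    AnalyticAt.fun_comp (f := fun v : ℂ × ℂ × ℂ => ((v.2.1, 0) : ℂ × ℂ)) hg hι
  have hf : AnalyticAt ℂ (fun v : ℂ × ℂ × ℂ => f (v.2.1, 0) v.2.2) 0 :=
    (((hι' ha22).neg.sub ((hι' ha).mul (hι' hu))).sub ((hι' ha2).mul hW)).sub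
      ((analyticAt_const.mul (hι' ha)).mul (hW.pow 2))
  obtain ⟨w₀, hw₀, hw₀0, hw₀'⟩ :=
    exists_analyticAt_hasDerivAt hf (c := fun _ => 0) analyticAt_const rfl
  let c : ℂ → ℂ := fun x => w₀ (0, x)
  have hc : AnalyticAt ℂ c 0 :=
    AnalyticAt.fun_comp (f := fun x : ℂ => ((0, x) : ℂ × ℂ)) hw₀
      (analyticAt_const.prod analyticAt_id)
  have hc' : ∀ᶠ x in 𝓝 (0 : ℂ), HasDerivAt c (f (x, 0) (c x)) x := by
    have ht : Tendsto (fun x : ℂ => ((0, x) : ℂ × ℂ)) (𝓝 0) (𝓝 0) :=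
      (by fun_prop : Continuous fun x : ℂ => ((0, x) : ℂ × ℂ)).tendsto' _ _ rfl
    exact (ht.eventually hw₀').mono fun x hx => hx.2
  have hg : AnalyticAt ℂ (fun v : ℂ × ℂ × ℂ => u (v.1, v.2.1) + (1 / 2) * v.2.2 ^ 2) 0 :=
    (AnalyticAt.fun_comp (f := fun v : ℂ × ℂ × ℂ => ((v.1, v.2.1) : ℂ × ℂ)) hu hπ).add
      (analyticAt_const.mul (hW.pow 2))
  obtain ⟨w, hw, -, hw'⟩ := exists_analyticAt_hasDerivAt hg hc hw₀0
  refine ⟨w, hw, ?_⟩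
  have hfst : Tendsto (Prod.fst : ℂ × ℂ → ℂ) (𝓝 0) (𝓝 0) := continuous_fst.tendsto' _ _ rfl
  obtain ⟨r, hr, hball⟩ := Metric.eventually_nhds_iff_ball.1
    ((hua.and (ha.eventually_analyticAt.and (hu.eventually_analyticAt.and
      hw.eventually_analyticAt))).and (hw'.and (hfst.eventually hc')))
  filter_upwards [Metric.ball_mem_nhds (0 : ℂ × ℂ) hr] with p hp
  have hd2 : ∀ q ∈ Metric.ball (0 : ℂ × ℂ) r, d2 w q = u q + (1 / 2) * w q ^ 2 := fun q hq =>
    (hball q hq).2.1.2.deriv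
  refine ⟨hd2 p hp, ?_⟩
  have hmem : ∀ y ∈ Metric.ball (0 : ℂ) r, (p.1, y) ∈ Metric.ball (0 : ℂ × ℂ) r := by
    intro y hy
    rw [mem_ball_zero_iff] at *
    exact max_lt ((norm_fst_le p).trans_lt hp) hy
  have hE : ∀ y ∈ Metric.ball (0 : ℂ) r,
      HasDerivAt (fun y => d1 w (p.1, y) - f (p.1, y) (w (p.1, y)))
        (w (p.1, y) * (d1 w (p.1, y) - f (p.1, y) (w (p.1, y)))) y := by
    intro y hy
    have hq := hmem y hy
    obtain ⟨⟨e1, haq, huq, hwq⟩, -, -⟩ := hball _ hq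
    have hd2q := hd2 _ hq
    have ha2q := analyticAt_d2 haq
    have hwd := hasDerivAt_d2 hwq
    have hcomm : d2 (d1 w) (p.1, y) = d1 u (p.1, y) + w (p.1, y) * d1 w (p.1, y) := by
      rw [← d1_d2_comm hwq]
      have h : HasDerivAt (fun x => u (x, y) + (1 / 2) * w (x, y) ^ 2)
          (d1 u (p.1, y) + w (p.1, y) * d1 w (p.1, y)) p.1 := by
        refine ((hasDerivAt_d1 huq).add
          (((hasDerivAt_d1 hwq).pow 2).const_mul (1 / 2))).congr_deriv ?_
        push_cast
        ring
      refine (h.congr_of_eventuallyEq ?_).deriv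
      have ht : Tendsto (fun x : ℂ => (x, y)) (𝓝 p.1) (𝓝 (p.1, y)) :=
        (by fun_prop : Continuous fun x : ℂ => (x, y)).tendsto _
      exact (ht.eventually (Metric.isOpen_ball.mem_nhds hq)).mono fun x hx => hd2 _ hx
    have hf' := (((hasDerivAt_d2 (analyticAt_d2 ha2q)).neg.sub
      ((hasDerivAt_d2 haq).mul (hasDerivAt_d2 huq))).sub ((hasDerivAt_d2 ha2q).mul hwd)).sub
      (((hasDerivAt_d2 haq).const_mul (1 / 2)).mul (hwd.pow 2))
    refine ((hasDerivAt_d2 (analyticAt_d1 hwq)).sub hf').congr_deriv ?_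
    simp only [f, hcomm, hd2q, e1, Pi.pow_apply]
    push_cast
    ring
  have hp1 : (p.1, (0 : ℂ)) ∈ Metric.ball (0 : ℂ × ℂ) r := hmem 0 (Metric.mem_ball_self hr)
  have hE0 : d1 w (p.1, 0) - f (p.1, 0) (w (p.1, 0)) = 0 := by
    have hwc : w (p.1, 0) = c p.1 := (hball _ hp1).2.1.1
    rw [hwc, sub_eq_zero]
    refine ((hball _ hp1).2.2.congr_of_eventuallyEq ?_).deriv
    have ht : Tendsto (fun x : ℂ => (x, (0 : ℂ))) (𝓝 p.1) (𝓝 (p.1, 0)) :=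
      (by fun_prop : Continuous fun x : ℂ => (x, (0 : ℂ))).tendsto _
    exact (ht.eventually (Metric.isOpen_ball.mem_nhds hp1)).mono fun x hx => (hball _ hx).2.1.1
  have hwdiff : DifferentiableOn ℂ (fun y => w (p.1, y)) (Metric.ball 0 r) := fun y hy =>
    (hasDerivAt_d2 (hball _ (hmem y hy)).1.2.2.2).differentiableAt.differentiableWithinAt
  have hp2 : p.2 ∈ Metric.ball (0 : ℂ) r := by
    rw [mem_ball_zero_iff] at *
    exact (norm_snd_le p).trans_lt hp
  exact sub_eq_zero.1 (eq_zero_of_hasDerivAt_mul hr hwdiff hE hE0 p.2 hp2)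

/-- solvability of the auxiliary Riccati-type PDE system for `w`. -/
theorem stmt_14 (X₁ X₂ : MvPolynomial (Fin 2) ℂ)
    (hX₁ : pev X₁ ((0 : ℂ), (0 : ℂ)) ≠ 0)
    (u : ℂ × ℂ → ℂ) (hu : AnalyticAt ℂ u ((0 : ℂ), (0 : ℂ)))
    (hXu : ∀ᶠ q in nhds ((0 : ℂ), (0 : ℂ)),
      Xop X₁ X₂ u q = 2 * B X₁ X₂ 0 q * u q + B X₁ X₂ 2 q) :
    ∃ w : ℂ × ℂ → ℂ, AnalyticAt ℂ w ((0 : ℂ), (0 : ℂ)) ∧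
      ∀ᶠ q in nhds ((0 : ℂ), (0 : ℂ)),
        d2 w q = u q + (1 / 2) * w q ^ 2 ∧
        d1 w q =
          -(d2^[2] (fun r => pev X₂ r / pev X₁ r) q)
            - (pev X₂ q / pev X₁ q) * u q
            - d2 (fun r => pev X₂ r / pev X₁ r) q * w q
            - (1 / 2) * (pev X₂ q / pev X₁ q) * w q ^ 2 := by
  have ha : AnalyticAt ℂ (fun r => pev X₂ r / pev X₁ r) 0 :=
    (analyticAt_pev X₂ _).div (analyticAt_pev X₁ _) hX₁
  refine exists_analyticAt_riccati_system ha hu ?_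
  have hne : ∀ᶠ q in 𝓝 (0 : ℂ × ℂ), pev X₁ q ≠ 0 :=
    (analyticAt_pev X₁ _).continuousAt.eventually_ne hX₁
  filter_upwards [hXu, hne] with q hq hX
  simp only [Xop, B, Function.iterate_succ, Function.iterate_zero, Function.comp_apply,
    zero_add, id_eq] at hq
  field_simp at hq ⊢
  linear_combination hq
end

section
/- Consider the Riccati equation dx₂/dx₁ = p(x₁)·x₂² + q(x₁)·x₂ + r(x₁) with p, q, r polynomials, i.e., the operator X with X₁ = 1 and X₂ = p(x₁)·x₂² + q(x₁)·x₂ + r(x₁). Then for every point (x₁⁰,x₂⁰) ∈ ℂ² there exists a first integral ω of X at (x₁⁰,x₂⁰) such that ∂₂ω is nonvanishing in a neighborhood of (x₁⁰,x₂⁰) and 2·∂₂ω·∂₂³ω − 3·(∂₂²ω)² = 0 identically in that neighborhood (vanishing Schwarzian in x₂; this is the order-at-most-3 content of the statement that the differential Galois group of the Riccati equation has order 3). -/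
open Filter MvPolynomial

open Topology Finset

/-- The coefficients of the power series solution of `F' = M F`, `F 0 = 1`, where `m` lists the
coefficients of `M`. -/
noncomputable def linearODECoeff {𝔸 : Type*} [NormedRing 𝔸] [NormedAlgebra ℂ 𝔸] (m : ℕ → 𝔸) :
    ℕ → 𝔸
  | 0 => 1
  | n + 1 => ((n : ℂ) + 1)⁻¹ • ∑ i : Fin (n + 1), m (n - i) * linearODECoeff m i

section LinearODE

variable {𝔸 : Type*} [NormedRing 𝔸] [NormedAlgebra ℂ 𝔸]

theorem succ_smul_linearODECoeff_succ (m : ℕ → 𝔸) (n : ℕ) :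
    ((n : ℂ) + 1) • linearODECoeff m (n + 1) =
      ∑ kl ∈ antidiagonal n, m kl.1 * linearODECoeff m kl.2 := by
  rw [linearODECoeff, smul_inv_smul₀ (Nat.cast_add_one_ne_zero n),
    Fin.sum_univ_eq_sum_range (fun i => m (n - i) * linearODECoeff m i) (n + 1),
    Nat.sum_antidiagonal_eq_sum_range_succ_mk, ← sum_range_reflect]
  refine sum_congr rfl fun i hi => ?_
  have : i ≤ n := Nat.lt_succ_iff.1 (mem_range.1 hi)
  simp only [Nat.add_sub_cancel, Nat.sub_sub_self this]

theorem norm_linearODECoeff_le {m : ℕ → 𝔸} {K : ℝ} (hm : ∀ n, ‖m n‖ ≤ K ^ (n + 1)) (n : ℕ) :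
    ‖linearODECoeff m n‖ ≤ ‖(1 : 𝔸)‖ * K ^ n := by
  induction n using Nat.strong_induction_on with
  | _ n ih =>
    cases n with
    | zero => simp [linearODECoeff]
    | succ n =>
      have hn : ((n : ℝ) + 1) ≠ 0 := Nat.cast_add_one_ne_zero n
      have hsum : ‖((n : ℂ) + 1) • linearODECoeff m (n + 1)‖ ≤
          ∑ kl ∈ antidiagonal n, ‖(1 : 𝔸)‖ * K ^ (n + 1) := by
        rw [succ_smul_linearODECoeff_succ]
        refine norm_sum_le_of_le _ fun kl hkl => ?_
        obtain rfl := mem_antidiagonal.1 hkl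
        calc ‖m kl.1 * linearODECoeff m kl.2‖
            ≤ ‖m kl.1‖ * ‖linearODECoeff m kl.2‖ := norm_mul_le _ _
          _ ≤ K ^ (kl.1 + 1) * (‖(1 : 𝔸)‖ * K ^ kl.2) :=
            mul_le_mul (hm _) (ih _ (by omega)) (norm_nonneg _) ((norm_nonneg _).trans (hm _))
          _ = ‖(1 : 𝔸)‖ * K ^ (kl.1 + kl.2 + 1) := by ring
      have hnorm : ‖(n : ℂ) + 1‖ = (n : ℝ) + 1 := by
        exact_mod_cast Complex.norm_natCast (n + 1)
      rw [norm_smul, hnorm, sum_const, Nat.card_antidiagonal, nsmul_eq_mul] at hsum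
      push_cast at hsum
      exact le_of_mul_le_mul_left hsum (by positivity)

theorem summable_norm_pow_smul {E : Type*} [NormedAddCommGroup E] [NormedSpace ℂ E] {v : ℕ → E}
    {A K : ℝ} (hK : 0 ≤ K) (hv : ∀ n, ‖v n‖ ≤ A * K ^ n) {z : ℂ} (hz : ‖z‖ * K < 1) :
    Summable fun n => ‖z ^ n • v n‖ := by
  refine ((summable_geometric_of_lt_one (by positivity) hz).mul_left A).of_nonneg_of_le
    (fun n => norm_nonneg _) fun n => ?_
  rw [norm_smul, norm_pow]
  calc ‖z‖ ^ n * ‖v n‖ ≤ ‖z‖ ^ n * (A * K ^ n) := by gcongr; exact hv n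
    _ = A * (‖z‖ * K) ^ n := by ring

theorem hasDerivAt_tsum_pow_smul {E : Type*} [NormedAddCommGroup E] [NormedSpace ℂ E]
    [CompleteSpace E] {v : ℕ → E} {A K ρ : ℝ} (hv : ∀ n, ‖v n‖ ≤ A * K ^ n) (hK : 0 < K)
    (hρ : 0 < ρ) (hρK : ρ * K < 1) {z : ℂ} (hz : ‖z‖ < ρ) :
    HasDerivAt (fun z : ℂ => ∑' n, z ^ n • v n)
      (∑' n : ℕ, ((n : ℂ) * z ^ (n - 1)) • v n) z := by
  have hgeom : Summable fun n : ℕ => (n : ℝ) ^ 1 * (ρ * K) ^ n :=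
    summable_pow_mul_geometric_of_norm_lt_one 1
      (by rwa [Real.norm_of_nonneg (mul_pos hρ hK).le])
  have hu : Summable fun n : ℕ => (A / ρ) * ((n : ℝ) ^ 1 * (ρ * K) ^ n) := hgeom.mul_left _
  have hsum : Summable fun n => (0 : ℂ) ^ n • v n :=
    (summable_norm_pow_smul hK.le hv (by simp)).of_norm
  have hbound : ∀ (n : ℕ) (y : ℂ), y ∈ Metric.ball (0 : ℂ) ρ →
      ‖((n : ℂ) * y ^ (n - 1)) • v n‖ ≤ (A / ρ) * ((n : ℝ) ^ 1 * (ρ * K) ^ n) := by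
    intro n y hy
    have hy : ‖y‖ < ρ := by simpa using hy
    rcases n with _ | n
    · simp
    · rw [norm_smul, norm_mul, norm_pow, Complex.norm_natCast, Nat.add_sub_cancel]
      calc ((n + 1 : ℕ) : ℝ) * ‖y‖ ^ n * ‖v (n + 1)‖
          ≤ ((n + 1 : ℕ) : ℝ) * ρ ^ n * (A * K ^ (n + 1)) := by
            gcongr; exact hv _
        _ = A / ρ * (((n + 1 : ℕ) : ℝ) ^ 1 * (ρ * K) ^ (n + 1)) := by
            field_simp
            ring
  exact hasDerivAt_tsum_of_isPreconnected (g := fun n y => y ^ n • v n)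
    (g' := fun n y => ((n : ℂ) * y ^ (n - 1)) • v n) hu
    Metric.isOpen_ball (convex_ball _ _).isPreconnected
    (fun n y _ => (hasDerivAt_pow n y).smul_const (v n)) hbound
    (Metric.mem_ball_self hρ) hsum (by simpa using hz)

/-- A linear differential equation with analytic coefficients has a local analytic fundamental
solution. -/
theorem exists_analyticAt_hasDerivAt_mul [CompleteSpace 𝔸] {M : ℂ → 𝔸} {z₀ : ℂ}
    (hM : AnalyticAt ℂ M z₀) :
    ∃ F : ℂ → 𝔸, F z₀ = 1 ∧ AnalyticAt ℂ F z₀ ∧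
      ∀ᶠ z in 𝓝 z₀, HasDerivAt F (M z * F z) z := by
  obtain ⟨p, hp⟩ := hM
  obtain ⟨C, r, hC, hr, hle⟩ : ∃ C r : ℝ, 0 < C ∧ 0 < r ∧ ∀ n, ‖p n‖ ≤ C * r ^ n := by
    obtain ⟨C, r, hC, hr, h⟩ := p.le_mul_pow_of_radius_pos hp.radius_pos
    exact ⟨C, r, hC, hr, h⟩
  set K : ℝ := max C (max r 1) with hK
  have hK1 : 1 ≤ K := (le_max_right _ _).trans (le_max_right _ _)
  have hK0 : 0 < K := one_pos.trans_le hK1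
  have hm : ∀ n, ‖p.coeff n‖ ≤ K ^ (n + 1) := fun n =>
    calc ‖p.coeff n‖ = ‖p n‖ := p.norm_apply_eq_norm_coef.symm
      _ ≤ C * r ^ n := hle n
      _ ≤ K * K ^ n := by
        gcongr
        · exact le_max_left _ _
        · exact (le_max_left _ _).trans (le_max_right _ _)
      _ = K ^ (n + 1) := by ring
  set v := linearODECoeff p.coeff with hv
  have hvle : ∀ n, ‖v n‖ ≤ ‖(1 : 𝔸)‖ * K ^ n := norm_linearODECoeff_le hm
  set ρ : ℝ := (2 * K)⁻¹ with hρ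
  have hρ0 : 0 < ρ := by positivity
  have hρK : ρ * K < 1 := by rw [hρ, mul_inv, mul_assoc, inv_mul_cancel₀ hK0.ne']; norm_num
  have hKz : ∀ z : ℂ, ‖z‖ < ρ → ‖z‖ * K < 1 := fun z hz =>
    (mul_le_mul_of_nonneg_right hz.le hK0.le).trans_lt hρK
  have hsv : ∀ z : ℂ, ‖z‖ < ρ → Summable fun n => ‖z ^ n • v n‖ := fun z hz =>
    summable_norm_pow_smul hK0.le hvle (hKz z hz)
  have hsm : ∀ z : ℂ, ‖z‖ < ρ → Summable fun n => ‖z ^ n • p.coeff n‖ := fun z hz =>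
    summable_norm_pow_smul hK0.le (fun n => (hm n).trans_eq (pow_succ' K n)) (hKz z hz)
  set G : ℂ → 𝔸 := fun z => ∑' n, z ^ n • v n with hG
  have hGderiv : ∀ z : ℂ, ‖z‖ < ρ →
      HasDerivAt G (∑' n : ℕ, ((n : ℂ) * z ^ (n - 1)) • v n) z := fun z hz =>
    hasDerivAt_tsum_pow_smul hvle hK0 hρ0 hρK hz
  have hderiv_eq : ∀ z : ℂ, ‖z‖ < ρ → ∑' n : ℕ, ((n : ℂ) * z ^ (n - 1)) • v n =
      (∑' n, z ^ n • p.coeff n) * G z := fun z hz => by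
    rw [hG, tsum_mul_tsum_eq_tsum_sum_antidiagonal_of_summable_norm (hsm z hz) (hsv z hz)]
    have hsucc : ∀ n : ℕ, (((n + 1 : ℕ) : ℂ) * z ^ (n + 1 - 1)) • v (n + 1) =
        ∑ kl ∈ antidiagonal n, z ^ kl.1 • p.coeff kl.1 * z ^ kl.2 • v kl.2 := fun n => by
      rw [Nat.add_sub_cancel, mul_comm, mul_smul, Nat.cast_add_one,
        hv, succ_smul_linearODECoeff_succ, smul_sum]
      refine sum_congr rfl fun kl hkl => ?_
      rw [← mem_antidiagonal.1 hkl, smul_mul_smul_comm, pow_add]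
    rw [← tsum_congr hsucc]
    exact (tsum_eq_zero_add' (f := fun n : ℕ => ((n : ℂ) * z ^ (n - 1)) • v n) (by
      simp_rw [hsucc]
      exact (summable_norm_sum_mul_antidiagonal_of_summable_norm
        (hsm z hz) (hsv z hz)).of_norm)).trans (by simp)
  have hball : ∀ᶠ z in 𝓝 z₀, ‖z - z₀‖ < ρ := by
    have : ContinuousAt (fun z : ℂ => ‖z - z₀‖) z₀ := by fun_prop
    exact this.eventually_lt continuousAt_const (by simpa)
  have hMsum : ∀ᶠ z in 𝓝 z₀, M z = ∑' n, (z - z₀) ^ n • p.coeff n := by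
    filter_upwards [hasFPowerSeriesAt_iff'.1 hp] with z hz using hz.tsum_eq.symm
  have hF : ∀ᶠ z in 𝓝 z₀, HasDerivAt (fun z => G (z - z₀)) (M z * G (z - z₀)) z := by
    filter_upwards [hball, hMsum] with z hz hMz
    rw [hMz, ← hderiv_eq _ hz]
    exact (hGderiv _ hz).comp_sub_const z z₀
  refine ⟨fun z => G (z - z₀), ?_, ?_, hF⟩
  · simp only [hG, sub_self]
    rw [tsum_eq_single 0 fun n hn => by simp [hn]]
    simp [hv, linearODECoeff]
  · rw [Complex.analyticAt_iff_eventually_differentiableAt]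
    exact hF.mono fun z hz => hz.differentiableAt

end LinearODE

theorem Polynomial.eval_aeval_X_zero (p : Polynomial ℂ) (v : Fin 2 → ℂ) :
    MvPolynomial.eval v (Polynomial.aeval (MvPolynomial.X 0 : MvPolynomial (Fin 2) ℂ) p) =
      p.eval (v 0) := by
  rw [← MvPolynomial.coe_aeval_eq_eval, RingHom.coe_coe, ← Polynomial.aeval_algHom_apply,
    MvPolynomial.aeval_X, Polynomial.coe_aeval_eq_eval]

/-- The linear system `a' = p b - q a`, `b' = -r a` has a fundamental system of local analytic
solutions with identity initial value. -/
theorem exists_analyticAt_riccati_system_s18 (p q r : Polynomial ℂ) (z₀ : ℂ) :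
    ∃ a b c d : ℂ → ℂ,
      (a z₀ = 1 ∧ b z₀ = 0 ∧ c z₀ = 0 ∧ d z₀ = 1) ∧
      (AnalyticAt ℂ a z₀ ∧ AnalyticAt ℂ b z₀ ∧ AnalyticAt ℂ c z₀ ∧ AnalyticAt ℂ d z₀) ∧
      ∀ᶠ z in 𝓝 z₀,
        HasDerivAt a (p.eval z * b z - q.eval z * a z) z ∧
        HasDerivAt b (-(r.eval z * a z)) z ∧
        HasDerivAt c (p.eval z * d z - q.eval z * c z) z ∧
        HasDerivAt d (-(r.eval z * c z)) z := by
  let π₁ := ContinuousLinearMap.fst ℂ ℂ ℂ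
  let π₂ := ContinuousLinearMap.snd ℂ ℂ ℂ
  let ι₁ := ContinuousLinearMap.inl ℂ ℂ ℂ
  let ι₂ := ContinuousLinearMap.inr ℂ ℂ ℂ
  let M : ℂ → (ℂ × ℂ) →L[ℂ] (ℂ × ℂ) := fun z =>
    p.eval z • ι₁.comp π₂ - q.eval z • ι₁.comp π₁ - r.eval z • ι₂.comp π₁
  have hpoly : ∀ s : Polynomial ℂ, AnalyticAt ℂ (fun z => s.eval z) z₀ := fun s =>
    s.differentiable.analyticAt z₀
  have hM : AnalyticAt ℂ M z₀ :=
    (((hpoly p).smul analyticAt_const).sub ((hpoly q).smul analyticAt_const)).sub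
      ((hpoly r).smul analyticAt_const)
  obtain ⟨F, hF0, hFa, hF⟩ := exists_analyticAt_hasDerivAt_mul hM
  have happ : ∀ (L : (ℂ × ℂ) →L[ℂ] ℂ) (w : ℂ × ℂ), AnalyticAt ℂ (fun z => L (F z w)) z₀ :=
    fun L w => ((L.comp (ContinuousLinearMap.apply ℂ (ℂ × ℂ) w)).analyticAt _).fun_comp hFa
  have hder : ∀ (L : (ℂ × ℂ) →L[ℂ] ℂ) (w : ℂ × ℂ) (z : ℂ), HasDerivAt F (M z * F z) z →
      HasDerivAt (fun z => L (F z w)) (L (M z (F z w))) z := fun L w z hz =>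
    (L.comp (ContinuousLinearMap.apply ℂ (ℂ × ℂ) w)).hasFDerivAt.comp_hasDerivAt z hz
  refine ⟨fun z => π₁ (F z (1, 0)), fun z => π₂ (F z (1, 0)), fun z => π₁ (F z (0, 1)),
    fun z => π₂ (F z (0, 1)), by simp [hF0, π₁, π₂],
    ⟨happ _ _, happ _ _, happ _ _, happ _ _⟩, hF.mono fun z hz => ⟨?_, ?_, ?_, ?_⟩⟩
  · simpa [M, π₁, π₂, ι₁, ι₂] using hder π₁ (1, 0) z hz
  · simpa [M, π₁, π₂, ι₁, ι₂] using hder π₂ (1, 0) z hz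
  · simpa [M, π₁, π₂, ι₁, ι₂] using hder π₁ (0, 1) z hz
  · simpa [M, π₁, π₂, ι₁, ι₂] using hder π₂ (0, 1) z hz

theorem d2_congr {f g : ℂ × ℂ → ℂ} {s : ℂ × ℂ} (h : f =ᶠ[𝓝 s] g) : d2 f s = d2 g s := by
  have hc : ContinuousAt (fun y : ℂ => (s.1, y)) s.2 := by fun_prop
  exact Filter.EventuallyEq.deriv_eq (hc.eventually h)

theorem hasDerivAt_const_div_linear_pow (k c d y : ℂ) (n : ℕ) (h : c * y + d ≠ 0) :
    HasDerivAt (fun y => k / (c * y + d) ^ n) (-(n * c * k) / (c * y + d) ^ (n + 1)) y := by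
  have hu : HasDerivAt (fun y : ℂ => c * y + d) c y := by
    simpa using ((hasDerivAt_id y).const_mul c).add_const d
  refine ((hasDerivAt_const y k).div (hu.pow n) (pow_ne_zero n h)).congr_deriv ?_
  rcases n with _ | n
  · simp
  · simp only [Pi.pow_apply, Nat.add_sub_cancel]
    field_simp
    push_cast
    ring

/-- for the Riccati equation (`X₁ = 1`, `X₂ = p(x₁)x₂² + q(x₁)x₂ + r(x₁)`),
every point admits a first integral with nonvanishing `∂₂ω` and vanishing Schwarzian-type
expression `2·∂₂ω·∂₂³ω − 3·(∂₂²ω)² = 0` in `x₂`. -/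
theorem stmt_18 (p q r : Polynomial ℂ) (X₁ X₂ : MvPolynomial (Fin 2) ℂ)
    (hX₁ : X₁ = 1)
    (hX₂ : X₂ =
      Polynomial.aeval (MvPolynomial.X 0 : MvPolynomial (Fin 2) ℂ) p
          * MvPolynomial.X 1 ^ 2
        + Polynomial.aeval (MvPolynomial.X 0 : MvPolynomial (Fin 2) ℂ) q
          * MvPolynomial.X 1
        + Polynomial.aeval (MvPolynomial.X 0 : MvPolynomial (Fin 2) ℂ) r) :
    ∀ x0 : ℂ × ℂ, ∃ ω : ℂ × ℂ → ℂ, IsFirstIntegralAt X₁ X₂ ω x0 ∧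
      (∀ᶠ s in nhds x0, d2 ω s ≠ 0) ∧
      ∀ᶠ s in nhds x0, 2 * d2 ω s * d2^[3] ω s - 3 * (d2^[2] ω s) ^ 2 = 0 := by
  intro x0
  obtain ⟨a, b, c, d, ⟨ha0, hb0, hc0, hd0⟩, ⟨ha, hb, hc, hd⟩, hode⟩ :=
    exists_analyticAt_riccati_system_s18 p q r x0.1
  set u : ℂ × ℂ → ℂ := fun s => c s.1 * s.2 + d s.1 with hu
  set ω : ℂ × ℂ → ℂ := fun s => (a s.1 * s.2 + b s.1) / u s with hω
  set D : ℂ → ℂ := fun x => a x * d x - b x * c x with hD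
  have hfst : ∀ {f : ℂ → ℂ}, AnalyticAt ℂ f x0.1 → AnalyticAt ℂ (fun s : ℂ × ℂ => f s.1) x0 :=
    fun hf => AnalyticAt.fun_comp hf analyticAt_fst
  have hua : AnalyticAt ℂ u x0 := ((hfst hc).mul analyticAt_snd).add (hfst hd)
  have hu0 : u x0 ≠ 0 := by simp [hu, hc0, hd0]
  have hωa : AnalyticAt ℂ ω x0 := (((hfst ha).mul analyticAt_snd).add (hfst hb)).div hua hu0
  have hune : ∀ᶠ s in 𝓝 x0, u s ≠ 0 := hua.continuousAt.eventually_ne hu0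
  have hDne : ∀ᶠ s in 𝓝 x0, D s.1 ≠ 0 :=
    (hfst ((ha.mul hd).sub (hb.mul hc))).continuousAt.eventually_ne
      (by simp [ha0, hb0, hc0, hd0])
  have hone : ∀ᶠ s in 𝓝 x0, d2 ω s = D s.1 / u s ^ 2 := by
    filter_upwards [hune] with s hs
    have hlin : ∀ k l : ℂ, HasDerivAt (fun y : ℂ => k * y + l) k s.2 := fun k l => by
      simpa using ((hasDerivAt_id s.2).const_mul k).add_const l
    refine ((hlin (a s.1) (b s.1)).div (hlin (c s.1) (d s.1)) hs).deriv.trans ?_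
    simp only [hD, hu]
    ring
  have htwo : ∀ᶠ s in 𝓝 x0, d2^[2] ω s = -(2 * c s.1 * D s.1) / u s ^ 3 := by
    filter_upwards [hune, hone.eventually_nhds] with s hs h
    refine (d2_congr h).trans ?_
    exact_mod_cast (hasDerivAt_const_div_linear_pow (D s.1) (c s.1) (d s.1) s.2 2 hs).deriv
  have hthree : ∀ᶠ s in 𝓝 x0, d2^[3] ω s = 6 * c s.1 ^ 2 * D s.1 / u s ^ 4 := by
    filter_upwards [hune, htwo.eventually_nhds] with s hs h
    rw [Function.iterate_succ_apply', d2_congr h]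
    refine (hasDerivAt_const_div_linear_pow
      (-(2 * c s.1 * D s.1)) (c s.1) (d s.1) s.2 3 hs).deriv.trans ?_
    push_cast
    ring
  have hne : ∀ᶠ s in 𝓝 x0, d2 ω s ≠ 0 := by
    filter_upwards [hone, hune, hDne] with s h hs hDs
    rw [h]
    exact div_ne_zero hDs (pow_ne_zero 2 hs)
  refine ⟨ω, ⟨hωa, ?_, ?_⟩, hne, ?_⟩
  · filter_upwards [hone, hune, continuousAt_fst.eventually hode] with s h hs ⟨h1, h2, h3, h4⟩
    have hd1 := (((h1.mul_const s.2).add h2).div ((h3.mul_const s.2).add h4) hs).deriv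
    have hX : pev X₂ s = p.eval s.1 * s.2 ^ 2 + q.eval s.1 * s.2 + r.eval s.1 := by
      simp [pev, hX₂, Polynomial.eval_aeval_X_zero]
    have hd1' : d1 ω s = _ := hd1
    have hs' : c s.1 * s.2 + d s.1 ≠ 0 := hs
    rw [Xop, hX, h, hd1']
    simp only [hX₁, pev, map_one, hD, hu, Pi.add_apply]
    field_simp
    ring
  · rintro ⟨k, hk⟩
    refine hne.self_of_nhds ((d2_congr (g := fun _ => k) hk).trans ?_)
    simp [d2]
  · filter_upwards [hone, htwo, hthree, hune] with s h1 h2 h3 hs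
    rw [h1, h2, h3]
    field_simp
    ring
end

section
/- Let μ be a nonzero complex number and consider the van der Pol system with X₁ = x₂ − μ·(x₁³/3 − x₁) and X₂ = −x₁. Then there is no rational function a in the field ℂ(x₁,x₂) satisfying X₁³·(X₁·∂₁a + X₂·∂₂a) + 2·x₁·X₁²·a + 6·x₁ = 0 (equivalently, the equation X(a) = 2·B₀·a + B₂ has no rational solution); consequently the order of the differential Galois group of the van der Pol equation is infinite. -/
open Filter MvPolynomial

open scoped Polynomial

section Recursion

lemma natDegree_natCast_add_one_mul_X_mul_le (i : ℕ) (q : ℂ[X]) :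
    (((i : ℂ[X]) + 1) * Polynomial.X * q).natDegree ≤ 1 + q.natDegree := by
  have h : ((i : ℂ[X]) + 1).natDegree = 0 := by
    exact_mod_cast Polynomial.natDegree_natCast (R := ℂ) (i + 1)
  refine Polynomial.natDegree_mul_le.trans (Nat.add_le_add_right ?_ _)
  refine Polynomial.natDegree_mul_le.trans ?_
  simp [h]

variable {r G : ℕ → ℂ[X]}

lemma le_natDegree_of_derivative_eq
    (hrec : ∀ i, (r i).derivative = G i * r (i + 1) + ((i : ℂ[X]) + 1) * Polynomial.X * r (i + 2))
    {i : ℕ} (hr : r (i + 1) ≠ 0) (hd : (r (i + 2)).natDegree ≤ (r (i + 1)).natDegree)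
    (hG : 2 ≤ (G i).natDegree) : (r (i + 1)).natDegree + 3 ≤ (r i).natDegree := by
  have hG0 : G i ≠ 0 := by
    rintro h
    simp [h] at hG
  have h1 : (G i * r (i + 1)).natDegree = (G i).natDegree + (r (i + 1)).natDegree :=
    Polynomial.natDegree_mul hG0 hr
  have h2 := natDegree_natCast_add_one_mul_X_mul_le i (r (i + 2))
  have h3 := congrArg Polynomial.natDegree (hrec i)
  rw [Polynomial.natDegree_add_eq_left_of_natDegree_lt (by lia), h1,
    Polynomial.natDegree_derivative] at h3
  lia

lemma false_of_two_le_natDegree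
    (hrec : ∀ i, (r i).derivative = G i * r (i + 1) + ((i : ℂ[X]) + 1) * Polynomial.X * r (i + 2))
    (h0 : r 0 = 0) (s : ℕ) (hr : r (s + 1) ≠ 0)
    (hd : (r (s + 2)).natDegree ≤ (r (s + 1)).natDegree)
    (hG : ∀ i ≤ s, 2 ≤ (G i).natDegree) : False := by
  induction s with
  | zero =>
    have := le_natDegree_of_derivative_eq hrec hr hd (hG 0 le_rfl)
    simp [h0] at this
  | succ s ih =>
    have := le_natDegree_of_derivative_eq hrec hr hd (hG (s + 1) le_rfl)
    refine ih ?_ (by lia) fun i hi => hG i (by lia)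
    intro h
    simp [h] at this

lemma natDegree_add_three_le
    (hrec : ∀ i, (r i).derivative = G i * r (i + 1) + ((i : ℂ[X]) + 1) * Polynomial.X * r (i + 2))
    {m : ℕ} (k : ℕ) (hr : r (m + k + 1) ≠ 0) (htop : r (m + k + 2) = 0)
    (hG : ∀ i, m < i → i ≤ m + k → 2 ≤ (G i).natDegree) :
    r (m + 1) ≠ 0 ∧
      (r (m + 2) = 0 ∧ k = 0 ∨ (r (m + 2)).natDegree + 3 ≤ (r (m + 1)).natDegree) := by
  induction k generalizing m with
  | zero => exact ⟨hr, Or.inl ⟨htop, rfl⟩⟩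
  | succ k ih =>
    obtain ⟨h1, h2⟩ := ih (m := m + 1) (by convert hr using 2; lia) (by rw [← htop]; congr 1; lia)
      fun i hi hi' => hG i (by lia) (by lia)
    have h3 : (r (m + 1 + 2)).natDegree ≤ (r (m + 1 + 1)).natDegree := by
      rcases h2 with ⟨h2, -⟩ | h2
      · simp [h2]
      · lia
    have := le_natDegree_of_derivative_eq hrec h1 h3 (hG (m + 1) (by lia) (by lia))
    refine ⟨?_, Or.inr this⟩
    intro h
    simp [h] at this

lemma coeff_mul_X_sq_sub_one (μ : ℂ) (q : ℂ[X]) (e : ℕ) :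
    (Polynomial.C μ * (Polynomial.X ^ 2 - 1) * q).coeff (e + 2)
      = μ * (q.coeff e - q.coeff (e + 2)) := by
  rw [mul_assoc, Polynomial.coeff_C_mul, sub_mul, one_mul, Polynomial.coeff_sub,
    Polynomial.coeff_X_pow_mul]

lemma coeff_natCast_add_one_mul_X_mul (i e : ℕ) (q : ℂ[X]) :
    (((i : ℂ[X]) + 1) * Polynomial.X * q).coeff (e + 1) = ((i : ℂ) + 1) * q.coeff e := by
  have : ((i : ℂ[X]) + 1) = Polynomial.C ((i : ℂ) + 1) := by simp
  rw [this, mul_assoc, Polynomial.coeff_C_mul, Polynomial.coeff_X_mul]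

/-- A solution of the recursion satisfied by the coefficients of an invariant curve of a
van der Pol vector field has only one nonzero term. -/
lemma eq_zero_of_recursion {μ : ℂ} (hμ : μ ≠ 0) (K : ℂ[X])
    (hGdef : ∀ i, G i = (i : ℂ[X]) * (Polynomial.C μ * (Polynomial.X ^ 2 - 1)) + K)
    (hrec : ∀ i, (r i).derivative = G i * r (i + 1) + ((i : ℂ[X]) + 1) * Polynomial.X * r (i + 2))
    (h0 : r 0 = 0) (n : ℕ) (hr : r (n + 1) ≠ 0) (htop : r (n + 2) = 0)
    (hconst : (r (n + 1)).natDegree = 0) : n = 0 := by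
  by_cases hall : ∀ i ≤ n, 2 ≤ (G i).natDegree
  · exact (false_of_two_le_natDegree hrec h0 n hr (by simp [htop]) hall).elim
  push Not at hall
  obtain ⟨m, hmn, hm⟩ := hall
  have hG : ∀ i, i ≠ m → 2 ≤ (G i).natDegree := by
    intro i hi
    apply Polynomial.le_natDegree_of_ne_zero
    have h1 : (G m).coeff 2 = 0 := Polynomial.coeff_eq_zero_of_natDegree_lt hm
    have h2 : G i = G m + Polynomial.C ((i : ℂ) - m) *
        (Polynomial.C μ * (Polynomial.X ^ 2 - 1)) := by
      rw [hGdef, hGdef]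
      simp
      ring
    rw [h2, Polynomial.coeff_add, h1, Polynomial.coeff_C_mul, Polynomial.coeff_C_mul]
    have h3 : (i : ℂ) - m ≠ 0 := sub_ne_zero.mpr (by exact_mod_cast hi)
    simp [Polynomial.coeff_one, h3, hμ]
  obtain ⟨k, rfl⟩ := Nat.exists_eq_add_of_le hmn
  obtain ⟨hrm, hdm⟩ := natDegree_add_three_le hrec k hr htop fun i hi _ => hG i (by lia)
  by_cases hGm : G m = 0
  · have hrm' := hrec m
    rw [hGm, zero_mul, zero_add] at hrm'
    rcases m with _ | m
    · by_contra hk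
      rcases hdm with ⟨-, hk0⟩ | hdm
      · exact hk (by simp [hk0])
      obtain ⟨k, rfl⟩ := Nat.exists_eq_succ_of_ne_zero (by simpa using hk)
      have := (natDegree_add_three_le hrec (m := 1) k (by convert hr using 2; lia)
        (by rw [← htop]; congr 1; lia) fun i hi _ => hG i (by lia)).1
      simp [h0, this] at hrm'
    exfalso
    have hGpred : G m = - (Polynomial.C μ * (Polynomial.X ^ 2 - 1)) := by
      have h1 := hGdef (m + 1)
      rw [hGm] at h1
      rw [hGdef]
      push_cast at h1
      linear_combination -h1
    have hGsucc : G (m + 2) = Polynomial.C μ * (Polynomial.X ^ 2 - 1) := by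
      have h1 := hGdef (m + 1)
      rw [hGm] at h1
      rw [hGdef]
      push_cast at h1 ⊢
      linear_combination -h1
    have hpred := hrec m
    have key : r m ≠ 0 ∧ (r (m + 1)).natDegree ≤ (r m).natDegree := by
      rcases hdm with ⟨hz, rfl⟩ | hdm
      · obtain ⟨b, hb⟩ := Polynomial.natDegree_eq_zero.mp hconst
        rw [hz, mul_zero] at hrm'
        have hd0 := Polynomial.derivative_eq_zero.mp hrm'
        refine ⟨?_, by simp [hd0]⟩
        obtain ⟨c, hc⟩ := Polynomial.natDegree_eq_zero.mp hd0
        intro hrm0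
        rw [hrm0, hGpred, show m + 2 = m + 1 + 0 + 1 from rfl, ← hc, ← hb] at hpred
        have h1 := congrArg (Polynomial.coeff · 1) hpred
        simp only [Polynomial.coeff_add] at h1
        rw [show (1 : ℕ) = 0 + 1 from rfl, coeff_natCast_add_one_mul_X_mul] at h1
        simp [Polynomial.coeff_one, Polynomial.coeff_X_pow] at h1
        rcases h1 with h1 | h1
        · exact absurd h1 (by exact_mod_cast Nat.succ_ne_zero m)
        · apply hr
          rw [← hb, h1, map_zero]
      · rcases k with _ | k
        · rw [show m + 1 + 2 = m + 1 + 0 + 2 from rfl] at hdm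
          simp at hdm hconst
          lia
        obtain ⟨hne, hdeg⟩ := natDegree_add_three_le hrec (m := m + 2) k
          (by convert hr using 2; lia) (by rw [← htop]; congr 1; lia) fun i hi _ => hG i (by lia)
        set e := (r (m + 3)).natDegree with he
        have ha : (r (m + 3)).coeff e ≠ 0 := by
          rw [he]
          simpa using hne
        have hsucc := hrec (m + 2)
        have hc4 : (r (m + 4)).coeff (e + 1) = 0 := by
          rcases hdeg with ⟨hz, -⟩ | hdeg
          · rw [show m + 4 = m + 2 + 2 from rfl, hz, Polynomial.coeff_zero]
          · exact Polynomial.coeff_eq_zero_of_natDegree_lt (by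
              rw [show m + 4 = m + 2 + 2 from rfl]
              lia)
        have hc2 : (r (m + 3)).coeff (e + 2) = 0 :=
          Polynomial.coeff_eq_zero_of_natDegree_lt (by lia)
        have hA := congrArg (Polynomial.coeff · (e + 2)) hsucc
        simp only [Polynomial.coeff_add] at hA
        rw [hGsucc, coeff_mul_X_sq_sub_one, show e + 2 = e + 1 + 1 from rfl,
          coeff_natCast_add_one_mul_X_mul, show m + 2 + 2 = m + 4 from rfl, hc4,
          show m + 2 + 1 = m + 3 from rfl, hc2, Polynomial.coeff_derivative] at hA
        have hB := congrArg (Polynomial.coeff · (e + 1)) hrm'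
        rw [coeff_natCast_add_one_mul_X_mul, Polynomial.coeff_derivative,
          show m + 1 + 2 = m + 3 from rfl] at hB
        have hdm1 : (r (m + 1)).natDegree ≤ e + 2 := by
          have h1 := congrArg Polynomial.natDegree hrm'
          rw [Polynomial.natDegree_derivative] at h1
          have h2 := natDegree_natCast_add_one_mul_X_mul_le (m + 1) (r (m + 3))
          rw [show m + 1 + 2 = m + 3 from rfl] at h1
          lia
        have hc0 : (r (m + 1)).coeff (e + 4) = 0 :=
          Polynomial.coeff_eq_zero_of_natDegree_lt (by lia)
        have hC := congrArg (Polynomial.coeff · (e + 4)) hpred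
        simp only [Polynomial.coeff_add] at hC
        rw [hGpred, neg_mul, Polynomial.coeff_neg, show e + 4 = e + 2 + 2 from rfl,
          coeff_mul_X_sq_sub_one, show e + 2 + 2 = e + 3 + 1 from rfl,
          coeff_natCast_add_one_mul_X_mul, Polynomial.coeff_derivative,
          show e + 3 + 1 = e + 4 from rfl, hc0] at hC
        have hne5 : (r m).coeff (e + 5) ≠ 0 := by
          intro hz
          rw [show e + 4 + 1 = e + 5 from rfl, hz] at hC
          rw [show e + 1 + 1 + 1 = e + 3 from rfl] at hA
          rw [show e + 1 + 1 = e + 2 from rfl] at hB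
          push_cast at hA hB hC
          rw [show m + 2 = m + 1 + 1 from rfl] at hC
          have h6 : μ * (r (m + 3)).coeff e * ((m : ℂ) + e + 4) = 0 := by
            linear_combination ((e : ℂ) + 2) * (e + 3) * hC + ((m : ℂ) + 1) * (e + 2) * hA
              - μ * (e + 3) * hB
          have h7 : ((m : ℂ) + e + 4) ≠ 0 := by exact_mod_cast (by lia : m + e + 4 ≠ 0)
          exact mul_ne_zero (mul_ne_zero hμ ha) h7 h6
        refine ⟨fun h => hne5 (by simp [h]), ?_⟩
        have := Polynomial.le_natDegree_of_ne_zero hne5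
        lia
    rcases m with _ | m
    · exact key.1 h0
    · exact false_of_two_le_natDegree hrec h0 m key.1 key.2 fun i hi => hG i (by lia)
  · exfalso
    have hder : (r m).derivative ≠ 0 ∧ (r (m + 1)).natDegree ≤ (r m).derivative.natDegree := by
      have h1 : (G m * r (m + 1)).natDegree = (G m).natDegree + (r (m + 1)).natDegree :=
        Polynomial.natDegree_mul hGm hrm
      rw [hrec m]
      rcases hdm with ⟨hz, -⟩ | hdm
      · rw [hz, mul_zero, add_zero]
        exact ⟨mul_ne_zero hGm hrm, by lia⟩
      · have h2 := natDegree_natCast_add_one_mul_X_mul_le m (r (m + 2))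
        have h3 := Polynomial.natDegree_add_eq_left_of_natDegree_lt
          (p := G m * r (m + 1)) (q := ((m : ℂ[X]) + 1) * Polynomial.X * r (m + 2)) (by lia)
        refine ⟨?_, by lia⟩
        intro h
        rw [h, Polynomial.natDegree_zero] at h3
        lia
    have key : r m ≠ 0 ∧ (r (m + 1)).natDegree ≤ (r m).natDegree := by
      refine ⟨fun hz => hder.1 (by simp [hz]), hder.2.trans ?_⟩
      rw [Polynomial.natDegree_derivative]
      lia
    rcases m with _ | m
    · exact key.1 h0
    · exact false_of_two_le_natDegree hrec h0 m key.1 key.2 fun i hi => hG i (by lia)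

end Recursion

section VanDerPol

/-- The van der Pol derivation in the coordinates `x` and `v = X₁`: it acts on `ℂ[x][v]` by
`v ∂ₓ - (μ (x² - 1) v + x) ∂ᵥ`. -/
noncomputable def vdpDer (μ : ℂ) : Derivation ℂ ℂ[X][X] ℂ[X][X] :=
  (Polynomial.X : ℂ[X][X]) •
      (PolynomialModule.equivPolynomialSelf (R := ℂ[X])).toLinearMap.compDer
        (Polynomial.derivative' (R := ℂ)).mapCoeffs
    - (Polynomial.C (Polynomial.C μ * (Polynomial.X ^ 2 - 1)) * Polynomial.X
        + Polynomial.C Polynomial.X : ℂ[X][X]) •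
      (Polynomial.derivative' (R := ℂ[X])).restrictScalars ℂ

lemma coeff_vdpDer (μ : ℂ) (p : ℂ[X][X]) (i : ℕ) :
    (vdpDer μ p).coeff i = ((Polynomial.X * p).coeff i).derivative
      - (i : ℂ[X]) * (Polynomial.C μ * (Polynomial.X ^ 2 - 1)) * p.coeff i
      - ((i : ℂ[X]) + 1) * Polynomial.X * p.coeff (i + 1) := by
  have h : ∀ j, (PolynomialModule.equivPolynomial (R := ℂ[X]) (S := ℂ[X])
      ((Polynomial.derivative' (R := ℂ)).mapCoeffs p)).coeff j = (p.coeff j).derivative := by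
    intro j
    rfl
  unfold vdpDer
  generalize Polynomial.C μ * (Polynomial.X ^ 2 - 1) = F
  cases i with
  | zero => simp [add_mul, mul_assoc, Polynomial.coeff_derivative]
  | succ i =>
    simp [add_mul, mul_assoc, Polynomial.coeff_derivative, h]
    ring

lemma vdpDer_X (μ : ℂ) : vdpDer μ (Polynomial.X : ℂ[X][X])
    = -(Polynomial.C (Polynomial.C μ * (Polynomial.X ^ 2 - 1)) * Polynomial.X
        + Polynomial.C Polynomial.X) := by
  simp [vdpDer]

lemma vdpDer_C_X (μ : ℂ) : vdpDer μ (Polynomial.C Polynomial.X : ℂ[X][X]) = Polynomial.X := by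
  simp [vdpDer]

lemma vdpDer_C_C (μ c : ℂ) : vdpDer μ (Polynomial.C (Polynomial.C c)) = 0 :=
  (vdpDer μ).map_algebraMap c

/-- The van der Pol vector field has no invariant algebraic curve. -/
lemma exists_eq_C_of_dvd_vdpDer {μ : ℂ} (hμ : μ ≠ 0) {p : ℂ[X][X]} (hp : p ≠ 0)
    (h : p ∣ vdpDer μ p) : ∃ c : ℂ, c ≠ 0 ∧ p = Polynomial.C (Polynomial.C c) := by
  obtain ⟨K, hK⟩ := h
  set n := p.natDegree with hn
  have hlead : p.coeff n ≠ 0 := by simpa [hn] using hp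
  have hKdeg : K.natDegree ≤ 1 := by
    by_cases hK0 : K = 0
    · simp [hK0]
    have h1 : (vdpDer μ p).natDegree ≤ n + 1 := by
      rw [Polynomial.natDegree_le_iff_coeff_eq_zero]
      intro N hN
      obtain ⟨N, rfl⟩ := Nat.exists_eq_succ_of_ne_zero (by lia : N ≠ 0)
      rw [coeff_vdpDer, Nat.succ_eq_add_one, Polynomial.coeff_X_mul,
        Polynomial.coeff_eq_zero_of_natDegree_lt (by lia : p.natDegree < N),
        Polynomial.coeff_eq_zero_of_natDegree_lt (by lia : p.natDegree < N + 1),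
        Polynomial.coeff_eq_zero_of_natDegree_lt (by lia : p.natDegree < N + 1 + 1)]
      simp
    rw [hK, Polynomial.natDegree_mul hp hK0] at h1
    lia
  have hz1 : p.coeff (n + 1) = 0 := Polynomial.coeff_eq_zero_of_natDegree_lt (by lia)
  have hz2 : p.coeff (n + 1 + 1) = 0 := Polynomial.coeff_eq_zero_of_natDegree_lt (by lia)
  have htop : (p.coeff n).derivative = p.coeff n * K.coeff 1 := by
    have h1 := congrArg (Polynomial.coeff · (n + 1)) hK
    simp only [coeff_vdpDer, Polynomial.coeff_X_mul, hz1, hz2, mul_zero, sub_zero] at h1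
    rw [h1, Polynomial.coeff_mul_add_eq_of_natDegree_le hn.ge hKdeg]
  have hder : (p.coeff n).derivative = 0 := by
    by_contra hne
    exact hne (Polynomial.eq_zero_of_dvd_of_degree_lt ⟨_, htop⟩
      (Polynomial.degree_derivative_lt hlead))
  have hK1 : K.coeff 1 = 0 := by
    rw [hder] at htop
    exact (mul_eq_zero.mp htop.symm).resolve_left hlead
  have hKC : K = Polynomial.C (K.coeff 0) := by
    apply Polynomial.eq_C_of_natDegree_le_zero
    rw [Polynomial.natDegree_le_iff_coeff_eq_zero]
    intro N hN
    rcases Nat.lt_or_ge 1 N with h1 | h1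
    · exact Polynomial.coeff_eq_zero_of_natDegree_lt (by lia)
    · rwa [show N = 1 by lia]
  have hconst := Polynomial.derivative_eq_zero.mp hder
  have hn0 : n = 0 := by
    refine eq_zero_of_recursion (r := fun i => (Polynomial.X * p).coeff i)
      (G := fun i => (i : ℂ[X]) * (Polynomial.C μ * (Polynomial.X ^ 2 - 1)) + K.coeff 0)
      hμ (K.coeff 0) (fun i => rfl) ?_ (by simp) n (by simpa using hlead) (by simpa using hz1)
      (by simpa using hconst)
    intro i
    have h1 := congrArg (Polynomial.coeff · i) hK
    rw [hKC] at h1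
    simp only [coeff_vdpDer, Polynomial.coeff_mul_C] at h1
    simp only [Polynomial.coeff_X_mul]
    linear_combination h1
  obtain ⟨c, hc⟩ := Polynomial.natDegree_eq_zero.mp hconst
  rw [hn0] at hc hlead
  refine ⟨c, fun h => hlead (by rw [← hc, h, map_zero]), ?_⟩
  rw [hc]
  exact Polynomial.eq_C_of_natDegree_eq_zero (hn.symm.trans hn0)

lemma false_of_vdpDer_eq {μ : ℂ} (hμ : μ ≠ 0) {c : ℂ} (hc : c ≠ 0) (k : ℕ) (w : ℂ[X][X])
    (hw : k ≠ 0 → ¬ Polynomial.X ∣ w)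
    (h : Polynomial.X ^ 3 * vdpDer μ w
      - (k : ℂ[X][X]) * Polynomial.X ^ 2 * w * vdpDer μ Polynomial.X
      + 2 * Polynomial.C Polynomial.X * Polynomial.X ^ 2 * w
      + 6 * Polynomial.C Polynomial.X * Polynomial.C (Polynomial.C c) * Polynomial.X ^ k = 0) :
    False := by
  rw [vdpDer_X] at h
  have hF : Polynomial.eval 0 (Polynomial.C μ * (Polynomial.X ^ 2 - 1)) ≠ 0 := by simpa
  generalize Polynomial.C μ * (Polynomial.X ^ 2 - 1) = F at h hF
  have hx : (Polynomial.X : ℂ[X]) ≠ 0 := Polynomial.X_ne_zero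
  have hco : ∀ (q : ℂ[X][X]), q.coeff 0 = Polynomial.eval 0 q :=
    fun q => Polynomial.coeff_zero_eq_eval_zero q
  rcases k with _ | _ | _ | k
  · have h1 := congrArg (Polynomial.eval 0) h
    simp [hc] at h1
  · have h2 : (Polynomial.X : ℂ[X][X]) * (Polynomial.X ^ 2 * vdpDer μ w
        + Polynomial.X * w * (Polynomial.C F * Polynomial.X + Polynomial.C Polynomial.X)
        + 2 * Polynomial.C Polynomial.X * Polynomial.X * w
        + 6 * Polynomial.C Polynomial.X * Polynomial.C (Polynomial.C c)) = 0 := by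
      rw [← h]
      push_cast
      ring
    have h1 := congrArg (Polynomial.eval 0) ((mul_eq_zero.mp h2).resolve_left Polynomial.X_ne_zero)
    simp [hc] at h1
  · have h2 : (Polynomial.X ^ 2 : ℂ[X][X]) * (Polynomial.X * (vdpDer μ w + 2 * (Polynomial.C F * w))
        + 4 * Polynomial.C Polynomial.X * w
        + 6 * Polynomial.C Polynomial.X * Polynomial.C (Polynomial.C c)) = 0 := by
      rw [← h]
      push_cast
      ring
    have h3 := (mul_eq_zero.mp h2).resolve_left (pow_ne_zero _ Polynomial.X_ne_zero)
    have h4 := congrArg (Polynomial.coeff · 0) h3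
    have h5 := congrArg (Polynomial.coeff · 1) h3
    rw [show (4 : ℂ[X][X]) = Polynomial.C 4 from rfl, show (6 : ℂ[X][X]) = Polynomial.C 6 from rfl,
      show (2 : ℂ[X][X]) = Polynomial.C 2 from rfl] at h4 h5
    simp [mul_assoc, coeff_vdpDer, Polynomial.coeff_C] at h4 h5
    have h6 : Polynomial.X * (4 * w.coeff 0 + 6 * Polynomial.C c) = 0 := by
      linear_combination h4
    have h7 := (mul_eq_zero.mp h6).resolve_left hx
    have h8 := congrArg (Polynomial.eval 0) h7
    have h9 := congrArg (Polynomial.eval 0) h5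
    simp [hF] at h8 h9
    simp [h9, hc] at h8
  · have h2 : (Polynomial.X ^ 2 : ℂ[X][X]) * (Polynomial.X * (vdpDer μ w
        + ((k : ℂ[X][X]) + 3) * w * Polynomial.C F
        + 6 * Polynomial.C Polynomial.X * Polynomial.C (Polynomial.C c) * Polynomial.X ^ k)
        + Polynomial.C (((k : ℂ[X]) + 5) * Polynomial.X) * w) = 0 := by
      rw [← h]
      simp only [map_mul, map_add, map_natCast, map_ofNat]
      push_cast
      ring
    have h3 := (mul_eq_zero.mp h2).resolve_left (pow_ne_zero _ Polynomial.X_ne_zero)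
    have h4 := congrArg (Polynomial.eval 0) h3
    have h5 : ((k : ℂ[X]) + 5) ≠ 0 := by exact_mod_cast (by lia : k + 5 ≠ 0)
    simp [h5] at h4
    apply hw (by lia)
    rwa [Polynomial.X_dvd_iff, hco]

lemma false_of_vdpDer_frac {μ : ℂ} (hμ : μ ≠ 0) (W₁ W₂ : ℂ[X][X]) (hW : W₂ ≠ 0)
    (h : Polynomial.X ^ 3 * (vdpDer μ W₁ * W₂ - W₁ * vdpDer μ W₂)
      + 2 * Polynomial.C Polynomial.X * Polynomial.X ^ 2 * W₁ * W₂
      + 6 * Polynomial.C Polynomial.X * W₂ ^ 2 = 0) : False := by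
  obtain ⟨w₂, w₁, d, hrel, rfl, rfl⟩ :=
    UniqueFactorizationMonoid.exists_reduced_factors W₂ hW W₁
  have hd : d ≠ 0 := left_ne_zero_of_mul hW
  have hw₂ : w₂ ≠ 0 := right_ne_zero_of_mul hW
  have h1 : Polynomial.X ^ 3 * (vdpDer μ w₁ * w₂ - w₁ * vdpDer μ w₂)
      + 2 * Polynomial.C Polynomial.X * Polynomial.X ^ 2 * w₁ * w₂
      + 6 * Polynomial.C Polynomial.X * w₂ ^ 2 = 0 := by
    refine (mul_eq_zero.mp ?_).resolve_left (pow_ne_zero 2 hd)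
    rw [← h]
    simp only [Derivation.leibniz, smul_eq_mul]
    ring
  have hdvd : w₂ ∣ Polynomial.X ^ 3 * vdpDer μ w₂ := by
    refine hrel.dvd_of_dvd_mul_left (y := w₁) ⟨Polynomial.X ^ 3 * vdpDer μ w₁
      + 2 * Polynomial.C Polynomial.X * Polynomial.X ^ 2 * w₁
      + 6 * Polynomial.C Polynomial.X * w₂, ?_⟩
    linear_combination -h1
  have hfin : FiniteMultiplicity (Polynomial.X : ℂ[X][X]) w₂ := by
    simpa using Polynomial.finiteMultiplicity_X_sub_C (0 : ℂ[X]) hw₂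
  obtain ⟨p, hp, hXp⟩ := hfin.exists_eq_pow_mul_and_not_dvd
  set k := multiplicity (Polynomial.X : ℂ[X][X]) w₂
  have hp0 : p ≠ 0 := by
    rintro rfl
    simp at hXp
  have hDw : Polynomial.X * vdpDer μ w₂ = Polynomial.X ^ k * (Polynomial.X * vdpDer μ p
      + (k : ℂ[X][X]) * p * vdpDer μ Polynomial.X) := by
    rw [hp, Derivation.leibniz, Derivation.leibniz_pow]
    rcases k with _ | k
    · simp
    · simp only [smul_eq_mul, nsmul_eq_mul, Nat.add_sub_cancel]
      ring
  have hpd : p ∣ vdpDer μ p := by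
    have hirr : IsRelPrime p (Polynomial.X ^ (k + 3) : ℂ[X][X]) :=
      ((Polynomial.prime_X.irreducible.isRelPrime_iff_not_dvd.mpr hXp).pow_left).symm
    refine hirr.dvd_of_dvd_mul_left ?_
    have h2 : p ∣ Polynomial.X ^ 3 * vdpDer μ w₂ :=
      (Dvd.intro_left _ hp.symm).trans hdvd
    have h3 : Polynomial.X ^ (k + 3) * vdpDer μ p = Polynomial.X ^ 3 * vdpDer μ w₂
        - p * (Polynomial.X ^ (k + 2) * (k : ℂ[X][X]) * vdpDer μ Polynomial.X) := by
      linear_combination -(Polynomial.X ^ 2 : ℂ[X][X]) * hDw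
    rw [h3]
    exact dvd_sub h2 (dvd_mul_right _ _)
  obtain ⟨c, hc, rfl⟩ := exists_eq_C_of_dvd_vdpDer hμ hp0 hpd
  refine false_of_vdpDer_eq hμ hc k w₁ ?_ ?_
  · intro hk hX
    refine Polynomial.prime_X.not_isUnit (hrel ?_ hX)
    rw [hp]
    exact (dvd_pow_self _ hk).mul_right _
  · refine (mul_eq_zero.mp ?_).resolve_left
      (mul_ne_zero (pow_ne_zero k (Polynomial.X_ne_zero (R := ℂ[X]))) hp0)
    rw [vdpDer_C_C] at hDw
    rw [← h1]
    linear_combination ((Polynomial.X ^ 2 : ℂ[X][X]) * w₁) * hDw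
      - (Polynomial.X ^ 3 * vdpDer μ w₁ + 2 * Polynomial.C Polynomial.X * Polynomial.X ^ 2 * w₁
        + 6 * Polynomial.C Polynomial.X
          * (w₂ + Polynomial.X ^ k * Polynomial.C (Polynomial.C c))) * hp

/-- The change of coordinates from `(x₁, x₂)` to `(x, v)` with `v = X₁`. -/
noncomputable def toLienard (μ : ℂ) : MvPolynomial (Fin 2) ℂ →ₐ[ℂ] ℂ[X][X] :=
  MvPolynomial.aeval ![Polynomial.C Polynomial.X, Polynomial.X + Polynomial.C
    (Polynomial.C μ * (Polynomial.C 3⁻¹ * Polynomial.X ^ 3 - Polynomial.X))]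

lemma toLienard_injective (μ : ℂ) : Function.Injective (toLienard μ) := by
  let x : MvPolynomial (Fin 2) ℂ := MvPolynomial.X 0
  let f : MvPolynomial (Fin 2) ℂ := MvPolynomial.X 1
      - MvPolynomial.C μ * (MvPolynomial.C (3⁻¹ : ℂ) * MvPolynomial.X 0 ^ 3 - MvPolynomial.X 0)
  let ψ : ℂ[X][X] →+* MvPolynomial (Fin 2) ℂ :=
    Polynomial.eval₂RingHom (Polynomial.aeval (R := ℂ) x).toRingHom f
  have h : ψ.comp (toLienard μ).toRingHom = RingHom.id _ := by
    apply MvPolynomial.ringHom_ext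
    · intro a
      have : (toLienard μ) (MvPolynomial.C a) = Polynomial.C (Polynomial.C a) :=
        (toLienard μ).commutes a
      simp [this, ψ, MvPolynomial.algebraMap_eq]
    · intro i
      fin_cases i
      · simp [ψ, toLienard, x]
      · simp [ψ, toLienard, x, f, Polynomial.eval₂_pow, MvPolynomial.algebraMap_eq]
  exact Function.LeftInverse.injective (g := ψ) fun p => congrArg (· p) h

lemma toLienard_pderiv (μ : ℂ) (p : MvPolynomial (Fin 2) ℂ) :
    Polynomial.X * toLienard μ (pderiv 0 p) - Polynomial.C Polynomial.X * toLienard μ (pderiv 1 p)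
      = vdpDer μ (toLienard μ p) := by
  induction p using MvPolynomial.induction_on with
  | C a =>
    have : (toLienard μ) (MvPolynomial.C a) = algebraMap ℂ _ a := (toLienard μ).commutes a
    rw [this, Derivation.map_algebraMap]
    simp
  | add p q hp hq =>
    simp only [map_add]
    linear_combination hp + hq
  | mul_X p i hp =>
    simp only [Derivation.leibniz, smul_eq_mul, map_add, map_mul]
    have hi : Polynomial.X * toLienard μ (pderiv 0 (MvPolynomial.X i))
        - Polynomial.C Polynomial.X * toLienard μ (pderiv 1 (MvPolynomial.X i))
          = vdpDer μ (toLienard μ (MvPolynomial.X i)) := by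
      fin_cases i
      · simp [toLienard, vdpDer_C_X, pderiv_X]
      · have h3 : (Polynomial.C (Polynomial.C 3⁻¹) : ℂ[X][X]) * 3 = 1 := by
          rw [show (3 : ℂ[X][X]) = Polynomial.C (Polynomial.C 3) from rfl]
          simp only [← map_mul]
          norm_num
        simp [toLienard, vdpDer_X, vdpDer_C_X, vdpDer_C_C, pderiv_X, Derivation.leibniz_pow]
        linear_combination -(Polynomial.C (Polynomial.C μ) * Polynomial.C Polynomial.X ^ 2
          * Polynomial.X : ℂ[X][X]) * h3
    linear_combination toLienard μ p * hi + toLienard μ (MvPolynomial.X i) * hp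

end VanDerPol

/-- for the van der Pol system (`X₁ = x₂ − μ(x₁³/3 − x₁)`, `X₂ = −x₁`,
`μ ≠ 0`), the equation `X₁³·X(a) + 2x₁X₁²·a + 6x₁ = 0` has no rational solution
`a = W₁/W₂` in `ℂ(x₁,x₂)` (the equation is stated cleared of denominators). -/
theorem stmt_19 (μ : ℂ) (hμ : μ ≠ 0) (X₁ X₂ : MvPolynomial (Fin 2) ℂ)
    (hX₁ : X₁ = MvPolynomial.X 1
      - MvPolynomial.C μ * (MvPolynomial.C (3⁻¹ : ℂ) * MvPolynomial.X 0 ^ 3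
          - MvPolynomial.X 0))
    (hX₂ : X₂ = -MvPolynomial.X 0) :
    ¬ ∃ W₁ W₂ : MvPolynomial (Fin 2) ℂ, W₂ ≠ 0 ∧
      X₁ ^ 3 * (X₁ * (pderiv (0 : Fin 2) W₁ * W₂ - W₁ * pderiv (0 : Fin 2) W₂)
          + X₂ * (pderiv (1 : Fin 2) W₁ * W₂ - W₁ * pderiv (1 : Fin 2) W₂))
        + 2 * MvPolynomial.X 0 * X₁ ^ 2 * W₁ * W₂
        + 6 * MvPolynomial.X 0 * W₂ ^ 2 = 0 := by
  rintro ⟨W₁, W₂, hW, h⟩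
  have hX₁' : toLienard μ X₁ = Polynomial.X := by
    subst hX₁
    have hC (a : ℂ) : toLienard μ (MvPolynomial.C a) = Polynomial.C (Polynomial.C a) :=
      (toLienard μ).commutes a
    simp [hC]
    simp [toLienard]
  have hX0 : toLienard μ (MvPolynomial.X 0) = Polynomial.C Polynomial.X := by
    simp [toLienard]
  refine false_of_vdpDer_frac hμ (toLienard μ W₁) (toLienard μ W₂)
    ((map_ne_zero_iff _ (toLienard_injective μ)).mpr hW) ?_
  have h1 := congrArg (toLienard μ) h
  subst hX₂
  simp only [map_add, map_mul, map_sub, map_pow, map_neg, map_ofNat, map_zero, hX₁', hX0] at h1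
  rw [← toLienard_pderiv, ← toLienard_pderiv]
  linear_combination h1
end
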